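/- Let a ∈ (-1,1), q > 0, m ≥ 1 an integer, and s¹, …, s^m > 0. Consider the private-prior cascade of m coupled Riccati iterations defined for k ≥ 1 by: r_k¹ = s¹; for i = 2,…,m, r_k^i = s¹ + Σ_{j=2}^{i} s^j/(α_k^{j−1})², where α_k^i = p_k^i/(p_k^i + r_k^i); and p_{k+1}^i = a²p_k^i − (a p_k^i)²/(p_k^i + r_k^i) + q, with arbitrary initial values p_1^i > 0. Then for each i ∈ {1,…,m}: (1) the numbers r_∞^i defined recursively by r_∞^1 = s¹ and r_∞^i = r_∞^{i−1} + s^i/(α_∞^{i−1})², with α_∞^i = p_∞^i/(p_∞^i + r_∞^i) and p_∞^i the unique positive solution of p = a²p − (ap)²/(p + r_∞^i) + q, are well defined and positive; (2) p_k^i → p_∞^i as k → ∞; and (3) (1 − α_∞^i)·a ∈ (−1,1). -/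

import Mathlib

open Filter Topology in
lemma aux_contract (c : ℝ) (hc0 : 0 ≤ c) (hc1 : c < 1) (e d : ℕ → ℝ) (he : ∀ k, 0 ≤ e k)
    (hd : Tendsto d atTop (𝓝 0)) (h : ∀ k ≥ 1, e (k+1) ≤ c * e k + d k) :
    Tendsto e atTop (𝓝 0) := by
  rw [Metric.tendsto_atTop]
  intro ε hε
  have hpos : 0 < (1 - c) * (ε / 2) := by
    have : 0 < 1 - c := by linarith
    positivity
  obtain ⟨N0, hN0⟩ := (Metric.tendsto_atTop.1 hd) _ hpos
  let N := max N0 1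
  have key : ∀ n, e (N + n) ≤ c ^ n * e N + ε / 2 := by
    intro n
    induction n with
    | zero => simp; linarith
    | succ n ih =>
      have h1 := h (N + n) (le_trans (le_max_right N0 1) (Nat.le_add_right _ _))
      have h2 := hN0 (N + n) (le_trans (le_max_left N0 1) (Nat.le_add_right _ _))
      rw [Real.dist_eq, sub_zero] at h2
      have h3 := (abs_lt.1 h2).2
      have h4 := mul_le_mul_of_nonneg_left ih hc0
      rw [pow_succ]
      have h5 : e (N + (n + 1)) = e (N + n + 1) := rfl
      rw [h5]
      nlinarith
  have ht : Tendsto (fun n => c ^ n * e N) atTop (𝓝 0) := by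
    simpa using (tendsto_pow_atTop_nhds_zero_of_lt_one hc0 hc1).mul_const (e N)
  obtain ⟨M, hM⟩ := (Metric.tendsto_atTop.1 ht) (ε / 2) (by linarith)
  refine ⟨N + M, fun n hn => ?_⟩
  obtain ⟨j, rfl⟩ := Nat.exists_eq_add_of_le (le_trans (Nat.le_add_right N M) hn)
  have h2 := hM j (by omega)
  rw [Real.dist_eq, sub_zero] at h2 ⊢
  rw [abs_of_nonneg (he _)]
  have := key j
  have := (abs_lt.1 h2).2
  linarith

noncomputable def dareSol (a q R : ℝ) : ℝ :=
  (-(R - a^2*R - q) + Real.sqrt ((R - a^2*R - q)^2 + 4*q*R)) / 2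

noncomputable def cascR (a q : ℝ) (s : ℕ → ℝ) : ℕ → ℝ
  | 0 => s 1
  | 1 => s 1
  | (n+2) => cascR a q s (n+1) + s (n+2) /
      (dareSol a q (cascR a q s (n+1)) / (dareSol a q (cascR a q s (n+1)) + cascR a q s (n+1)))^2

lemma dareSol_pos (a q R : ℝ) (hq : 0 < q) (hR : 0 < R) : 0 < dareSol a q R := by
  unfold dareSol
  have h : (R - a^2*R - q) < Real.sqrt ((R - a^2*R - q)^2 + 4*q*R) := by
    apply Real.lt_sqrt_of_sq_lt
    have : 0 < q * R := mul_pos hq hR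
    linarith
  linarith

lemma dareSol_quad (a q R : ℝ) (hq : 0 < q) (hR : 0 < R) :
    dareSol a q R ^ 2 + (R - a^2*R - q) * dareSol a q R - q * R = 0 := by
  have h0 : 0 ≤ (R - a^2*R - q)^2 + 4*q*R := by positivity
  have := Real.sq_sqrt h0
  unfold dareSol
  linear_combination this / 4

lemma dare_iff (a q R x : ℝ) (hR : 0 < R) (hx : 0 < x) :
    x = a ^ 2 * x - (a * x) ^ 2 / (x + R) + q ↔ x ^ 2 + (R - a^2*R - q) * x - q * R = 0 := by
  have : x + R ≠ 0 := by positivity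
  field_simp
  constructor <;> intro h <;> linarith

lemma dare_unique (a q R x y : ℝ) (hq : 0 < q) (hR : 0 < R) (hx : 0 < x) (hy : 0 < y)
    (h1 : x ^ 2 + (R - a^2*R - q) * x - q * R = 0)
    (h2 : y ^ 2 + (R - a^2*R - q) * y - q * R = 0) : x = y := by
  have h3 : (x - y) * (x * y + q * R) = 0 := by linear_combination y * h1 - x * h2
  have : 0 < x * y + q * R := by positivity
  rcases mul_eq_zero.1 h3 with h | h
  · linarith
  · linarith

lemma ric_eq (a q x r : ℝ) (h : 0 < x + r) :
    a ^ 2 * x - (a * x) ^ 2 / (x + r) + q = a^2 * (x * r / (x + r)) + q := by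
  field_simp; ring

open Filter Topology in
lemma ric_tendsto (a q R : ℝ) (ha : a ∈ Set.Ioo (-1 : ℝ) 1) (hq : 0 < q) (hR : 0 < R)
    (p r : ℕ → ℝ) (hp : ∀ k ≥ 1, 0 < p k) (hr : ∀ k ≥ 1, 0 < r k)
    (hrec : ∀ k ≥ 1, p (k + 1) = a ^ 2 * p k - (a * p k) ^ 2 / (p k + r k) + q)
    (hrt : Tendsto r atTop (𝓝 R)) : Tendsto p atTop (𝓝 (dareSol a q R)) := by
  have hP := dareSol_pos a q R hq hR
  have hE := (dare_iff a q R _ hR hP).2 (dareSol_quad a q R hq hR)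
  generalize dareSol a q R = P at hP hE
  rw [ric_eq _ _ _ _ (by linarith)] at hE
  have ha2 : a ^ 2 < 1 := by nlinarith [ha.1, ha.2]
  have hd : Tendsto (fun k => a^2 * |P * r k / (P + r k) - P * R / (P + R)|) atTop (𝓝 0) := by
    have h1 : Tendsto (fun k => P * r k / (P + r k)) atTop (𝓝 (P * R / (P + R))) :=
      (hrt.const_mul P).div (hrt.const_add P) (by positivity)
    have h2 := ((h1.sub_const (P * R / (P + R))).abs).const_mul (a^2)
    simpa using h2
  have := aux_contract (a^2) (sq_nonneg a) ha2 (fun k => |p k - P|) _ (fun k => abs_nonneg _) hd ?_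
  · have h3 := (tendsto_zero_iff_abs_tendsto_zero _).2 this
    simpa using h3.add_const P
  · intro k hk
    have h1 := hp k hk
    have h2 := hr k hk
    show |p (k+1) - P| ≤ _
    rw [hrec k hk, ric_eq _ _ _ _ (by linarith)]
    have e1 : a^2 * (p k * r k / (p k + r k)) + q - P =
        a^2 * ((r k / (p k + r k)) * (r k / (P + r k)) * (p k - P)) +
        a^2 * (P * r k / (P + r k) - P * R / (P + R)) := by
      have : a^2 * (p k * r k / (p k + r k)) + q - P = a^2 * (p k * r k / (p k + r k)) -
        a^2 * (P * R / (P + R)) := by linarith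
      rw [this]
      field_simp
      ring
    rw [e1]
    refine (abs_add_le _ _).trans ?_
    rw [abs_mul (a^2), abs_mul (a^2), abs_of_nonneg (sq_nonneg a)]
    refine add_le_add (mul_le_mul_of_nonneg_left ?_ (sq_nonneg a)) le_rfl
    have b1 : 0 ≤ r k / (p k + r k) := by positivity
    have b2 : 0 ≤ r k / (P + r k) := by positivity
    have b3 : r k / (p k + r k) ≤ 1 := by rw [div_le_one (by positivity)]; linarith
    have b4 : r k / (P + r k) ≤ 1 := by rw [div_le_one (by positivity)]; linarith
    rw [abs_mul, abs_of_nonneg (mul_nonneg b1 b2)]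
    exact mul_le_of_le_one_left (abs_nonneg _) (mul_le_one₀ b3 b2 b4)

lemma ric_pos (a q : ℝ) (hq : 0 < q) (p r : ℕ → ℝ) (hr : ∀ k ≥ 1, 0 < r k)
    (hrec : ∀ k ≥ 1, p (k + 1) = a ^ 2 * p k - (a * p k) ^ 2 / (p k + r k) + q)
    (h1 : 0 < p 1) : ∀ k ≥ 1, 0 < p k := by
  intro k hk
  induction k, hk using Nat.le_induction with
  | base => exact h1
  | succ k hk ih =>
    have := hr k hk
    rw [hrec k hk, ric_eq _ _ _ _ (by linarith)]
    positivity

/-- Theorem 1 (private-prior cascade): for `a ∈ (-1,1)`, `q > 0`, `m ≥ 1` agents with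
positive noise variances `s¹,…,sᵐ`, consider the coupled Riccati iterations with
`r_k¹ = s¹`, `r_k^i = s¹ + Σ_{j=2}^{i} s^j/(α_k^{j−1})²`, `α_k^i = p_k^i/(p_k^i + r_k^i)`,
and `p_{k+1}^i = a²p_k^i − (a p_k^i)²/(p_k^i + r_k^i) + q` from arbitrary `p_1^i > 0`.
Then there are well-defined positive limits `r_∞^i` (given by the stated recursion),
each `p_∞^i` is the unique positive solution of the DARE with noise variance `r_∞^i`,
`p_k^i → p_∞^i`, and `(1 − α_∞^i)·a ∈ (−1,1)`. -/
theorem pp_cascade_convergence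
    (a q : ℝ) (ha : a ∈ Set.Ioo (-1 : ℝ) 1) (hq : 0 < q)
    (m : ℕ) (hm : 1 ≤ m) (s : ℕ → ℝ) (hs : ∀ i ∈ Finset.Icc 1 m, 0 < s i)
    (p r α : ℕ → ℕ → ℝ)
    (hα : ∀ k ≥ 1, ∀ i ∈ Finset.Icc 1 m, α k i = p k i / (p k i + r k i))
    (hr1 : ∀ k ≥ 1, r k 1 = s 1)
    (hri : ∀ k ≥ 1, ∀ i ∈ Finset.Icc 2 m,
      r k i = s 1 + ∑ j ∈ Finset.Icc 2 i, s j / (α k (j - 1)) ^ 2)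
    (hrec : ∀ k ≥ 1, ∀ i ∈ Finset.Icc 1 m,
      p (k + 1) i = a ^ 2 * p k i - (a * p k i) ^ 2 / (p k i + r k i) + q)
    (hp1 : ∀ i ∈ Finset.Icc 1 m, 0 < p 1 i) :
    ∃ rinf pinf αinf : ℕ → ℝ,
      (∀ i ∈ Finset.Icc 1 m, αinf i = pinf i / (pinf i + rinf i)) ∧
      rinf 1 = s 1 ∧
      (∀ i ∈ Finset.Icc 2 m, rinf i = rinf (i - 1) + s i / (αinf (i - 1)) ^ 2) ∧
      (∀ i ∈ Finset.Icc 1 m, 0 < rinf i) ∧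
      (∀ i ∈ Finset.Icc 1 m,
        0 < pinf i ∧
        pinf i = a ^ 2 * pinf i - (a * pinf i) ^ 2 / (pinf i + rinf i) + q ∧
        (∀ p' : ℝ, 0 < p' →
          p' = a ^ 2 * p' - (a * p') ^ 2 / (p' + rinf i) + q → p' = pinf i)) ∧
      (∀ i ∈ Finset.Icc 1 m,
        Filter.Tendsto (fun k => p k i) Filter.atTop (nhds (pinf i))) ∧
      (∀ i ∈ Finset.Icc 1 m, (1 - αinf i) * a ∈ Set.Ioo (-1 : ℝ) 1) := by
  have main : ∀ i, 1 ≤ i → i ≤ m → 0 < cascR a q s i ∧ (∀ k ≥ 1, 0 < r k i) ∧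
      (∀ k ≥ 1, 0 < p k i) ∧
      Filter.Tendsto (fun k => r k i) Filter.atTop (nhds (cascR a q s i)) ∧
      Filter.Tendsto (fun k => p k i) Filter.atTop (nhds (dareSol a q (cascR a q s i))) := by
    intro i hi
    induction i, hi using Nat.le_induction with
    | base =>
      intro _
      have hmem : 1 ∈ Finset.Icc 1 m := by simp [hm]
      have hs1 := hs 1 hmem
      have hR : 0 < cascR a q s 1 := hs1
      have hrp : ∀ k ≥ 1, 0 < r k 1 := fun k hk => by rw [hr1 k hk]; exact hs1
      have hpp := ric_pos a q hq (fun k => p k 1) (fun k => r k 1) hrp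
        (fun k hk => hrec k hk 1 hmem) (hp1 1 hmem)
      have hrt : Filter.Tendsto (fun k => r k 1) Filter.atTop (nhds (cascR a q s 1)) := by
        apply tendsto_const_nhds.congr'
        filter_upwards [Filter.eventually_ge_atTop 1] with k hk
        rw [hr1 k hk]; rfl
      exact ⟨hR, hrp, hpp, hrt, ric_tendsto a q _ ha hq hR _ _ hpp hrp
        (fun k hk => hrec k hk 1 hmem) hrt⟩
    | succ n hn ih =>
      intro hnm
      obtain ⟨iR, irp, ipp, irt, ipt⟩ := ih (by omega)
      have hmem : n + 1 ∈ Finset.Icc 1 m := by simp [hnm]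
      have hmemn : n ∈ Finset.Icc 1 m := by simp; omega
      have hs1 := hs _ hmem
      have iP := dareSol_pos a q _ hq iR
      have hcR : cascR a q s (n+1) = cascR a q s n + s (n+1) /
          (dareSol a q (cascR a q s n) / (dareSol a q (cascR a q s n) + cascR a q s n))^2 := by
        obtain ⟨j, rfl⟩ := Nat.exists_eq_add_of_le' hn
        rw [cascR]
      have hrk : ∀ k ≥ 1, r k (n+1) = r k n + s (n+1) / (p k n / (p k n + r k n))^2 := by
        intro k hk
        rw [hri k hk (n+1) (by simp; omega), Finset.sum_Icc_succ_top (by omega),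
          Nat.add_sub_cancel, hα k hk n hmemn, ← add_assoc]
        congr 1
        rcases Nat.lt_or_ge n 2 with h | h
        · obtain rfl : n = 1 := by omega
          simp [hr1 k hk]
        · rw [hri k hk n (by simp; omega)]
      have hR : 0 < cascR a q s (n+1) := by rw [hcR]; positivity
      have hrp : ∀ k ≥ 1, 0 < r k (n+1) := fun k hk => by
        rw [hrk k hk]
        have := irp k hk
        have := ipp k hk
        positivity
      have hpp := ric_pos a q hq (fun k => p k (n+1)) (fun k => r k (n+1)) hrp
        (fun k hk => hrec k hk _ hmem) (hp1 _ hmem)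
      have hrt : Filter.Tendsto (fun k => r k (n+1)) Filter.atTop (nhds (cascR a q s (n+1))) := by
        have ht : Filter.Tendsto (fun k => r k n + s (n+1) / (p k n / (p k n + r k n))^2)
            Filter.atTop (nhds (cascR a q s (n+1))) := by
          rw [hcR]
          exact irt.add (tendsto_const_nhds.div
            ((ipt.div (ipt.add irt) (by positivity)).pow 2) (by positivity))
        apply ht.congr'
        filter_upwards [Filter.eventually_ge_atTop 1] with k hk
        rw [hrk k hk]
      exact ⟨hR, hrp, hpp, hrt, ric_tendsto a q _ ha hq hR _ _ hpp hrp
        (fun k hk => hrec k hk _ hmem) hrt⟩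
  refine ⟨cascR a q s, fun i => dareSol a q (cascR a q s i),
    fun i => dareSol a q (cascR a q s i) / (dareSol a q (cascR a q s i) + cascR a q s i),
    fun _ _ => rfl, rfl, ?_, ?_, ?_, ?_, ?_⟩
  · intro i hi
    obtain ⟨j, rfl⟩ := Nat.exists_eq_add_of_le' (Finset.mem_Icc.1 hi).1
    show cascR a q s (j+2) = _
    rw [cascR]; rfl
  · intro i hi
    exact (main i (Finset.mem_Icc.1 hi).1 (Finset.mem_Icc.1 hi).2).1
  · intro i hi
    have hR := (main i (Finset.mem_Icc.1 hi).1 (Finset.mem_Icc.1 hi).2).1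
    have hP := dareSol_pos a q _ hq hR
    have hQ := dareSol_quad a q _ hq hR
    exact ⟨hP, (dare_iff a q _ _ hR hP).2 hQ, fun p' hp' h =>
      dare_unique a q _ _ _ hq hR hp' hP ((dare_iff a q _ _ hR hp').1 h) hQ⟩
  · intro i hi
    exact (main i (Finset.mem_Icc.1 hi).1 (Finset.mem_Icc.1 hi).2).2.2.2.2
  · intro i hi
    have hR := (main i (Finset.mem_Icc.1 hi).1 (Finset.mem_Icc.1 hi).2).1
    have hP := dareSol_pos a q _ hq hR
    show (1 - dareSol a q (cascR a q s i) / (dareSol a q (cascR a q s i) + cascR a q s i)) * a ∈ _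
    have h1 : 0 < dareSol a q (cascR a q s i) / (dareSol a q (cascR a q s i) + cascR a q s i) := by
      positivity
    have h2 : dareSol a q (cascR a q s i) / (dareSol a q (cascR a q s i) + cascR a q s i) < 1 := by
      rw [div_lt_one (by positivity)]; linarith
    obtain ⟨ha1, ha2⟩ := ha
    constructor <;> nlinarith
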